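/- Fix n ≥ 3 and a positive integer j, and let z ∈ ℂ be a nonzero complex number with z^{(n−1)j} = 1 and z^{n−1} ≠ 1. Let B₁(z), …, B_{n−2}(z) denote the reduced Burau matrices over ℂ with t = z. Then (B₁(z) B₂(z) ⋯ B_{n−2}(z))^{(n−1)j} = I_{n−1}; that is, the image of τ_{n−1}^j under the reduced Burau representation specialized at t = z is the identity matrix. -/

import Mathlib

open Matrix

/-- The reduced Burau matrix of the generator `σ_{k+1}` of `B_n`, over a commutative ring `R`
with parameter `t`.  Row `k` has entries `t, -t, 1` in columns `k-1, k, k+1` (when present);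
all other rows are the corresponding rows of the identity matrix. -/
def burauMatrix (n : ℕ) (R : Type*) [CommRing R] (t : R) (k : Fin (n - 1)) :
    Matrix (Fin (n - 1)) (Fin (n - 1)) R :=
  Matrix.of fun r c =>
    if r = k then
      if (c : ℕ) + 1 = (k : ℕ) then t
      else if c = k then -t
      else if (c : ℕ) = (k : ℕ) + 1 then 1
      else 0
    else if r = c then 1 else 0

/-- Action of a Burau matrix on a column vector `u 1, …, u (n - 1)`, where `u 0 = 0`. -/
lemma burauMatrix_mulVec {n : ℕ} {R : Type*} [CommRing R] (t : R) (k : Fin (n - 1))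
    (hk : (k : ℕ) + 1 < n - 1) (u : ℕ → R) (hu : u 0 = 0) :
    burauMatrix n R t k *ᵥ (fun r => u (r + 1)) =
      fun r : Fin (n - 1) =>
        if r = k then t * u k - t * u (k + 1) + u (k + 2) else u (r + 1) := by
  ext r
  by_cases hr : r = k
  · have key : ∀ c : Fin (n - 1), burauMatrix n R t k r c * u (c + 1) =
        (if (c : ℕ) + 1 = k then t * u k else 0) + (if c = k then -t * u (k + 1) else 0) +
          (if c = ⟨k + 1, hk⟩ then u (k + 2) else 0) := by
      intro c
      simp only [burauMatrix, Matrix.of_apply, hr, if_true, Fin.ext_iff]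
      split_ifs <;> first | omega | simp_all
    have hprev : ∑ c : Fin (n - 1), (if (c : ℕ) + 1 = k then t * u k else 0) = t * u k := by
      rcases Nat.eq_zero_or_pos (k : ℕ) with h0 | h0
      · simp [h0, hu]
      · rw [Finset.sum_eq_single ⟨k - 1, by omega⟩]
        · rw [if_pos (by simp only; omega)]
        · intro c _ hc
          exact if_neg fun h => hc (Fin.ext (by simp only; omega))
        · simp
    simp only [mulVec, dotProduct, key, Finset.sum_add_distrib, hprev]
    simp [hr]
    ring
  · simp [mulVec, dotProduct, burauMatrix, hr]

/-- Action of `B₁ ⋯ B_m` on a column vector `u 1, …, u (n - 1)`, where `u 0 = 0`. -/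
lemma prod_burauMatrix_mulVec {n : ℕ} {R : Type*} [CommRing R] (t : R) (m : ℕ)
    (hm : m < n - 1) (u : ℕ → R) (hu : u 0 = 0) :
    (List.ofFn fun i : Fin m => burauMatrix n R t (Fin.castLE hm.le i)).prod *ᵥ
        (fun r => u (r + 1)) =
      fun r : Fin (n - 1) =>
        if (r : ℕ) < m then t * u r - t * u m + u (m + 1) else u (r + 1) := by
  induction m generalizing u with
  | zero => simp
  | succ m ih =>
    rw [List.ofFn_succ', List.concat_eq_append, List.prod_append, List.prod_singleton,
      ← mulVec_mulVec, burauMatrix_mulVec _ _ (by simpa using hm) u hu]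
    have hupdate : (fun r : Fin (n - 1) =>
        if r = Fin.castLE hm.le (Fin.last m) then
          t * u (Fin.castLE hm.le (Fin.last m)) - t * u (Fin.castLE hm.le (Fin.last m) + 1) +
            u (Fin.castLE hm.le (Fin.last m) + 2)
        else u (r + 1)) = fun r : Fin (n - 1) =>
        Function.update u (m + 1) (t * u m - t * u (m + 1) + u (m + 2)) (r + 1) := by
      ext r
      simp [Function.update_apply, Fin.ext_iff]
    rw [hupdate]
    refine (ih (by omega) _ (by simp [hu])).trans ?_
    ext r
    rcases lt_trichotomy (r : ℕ) m with h | h | h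
    · have h' : (r : ℕ) ≠ m + 1 := by omega
      simp only [h, h', h.trans (Nat.lt_succ_self m), if_true, Function.update_self, ne_eq,
        not_false_eq_true, Function.update_of_ne, (Nat.lt_succ_self m).ne]
      ring
    · simp [h]
    · have h' : ¬ (r : ℕ) < m + 1 := by omega
      simp [h.ne', h.not_gt, h']

/-- The column vectors that diagonalise `B₁ ⋯ B_{N-1}` up to a cyclic shift of `y`. -/
noncomputable def cyclicVec {K : Type*} [Field K] (N : ℕ) (t : K) (y : ZMod N → K) (c : K) :
    Fin N → K :=
  fun r => y ((r + 1 : ℕ) : ZMod N) - y 0 + (t ^ ((r : ℕ) + 1) - 1) / (t ^ N - 1) * c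

lemma cyclicVec_surjective {K : Type*} [Field K] {N : ℕ} [NeZero N] {t : K} (ht : t ^ N ≠ 1)
    (v : Fin N → K) : ∃ y c, cyclicVec N t y c = v := by
  have hN : 0 < N := Nat.pos_of_ne_zero (NeZero.ne N)
  let c := v ⟨N - 1, by omega⟩
  let w : Fin N → K := fun r => v r - (t ^ ((r : ℕ) + 1) - 1) / (t ^ N - 1) * c
  have hval : ∀ r : Fin N, (((r + 1 : ℕ) : ZMod N) - 1).val = r := by
    intro r
    rw [Nat.cast_add, Nat.cast_one, add_sub_cancel_right, ZMod.val_natCast_of_lt r.isLt]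
  refine ⟨fun i => w ⟨(i - 1).val, ZMod.val_lt _⟩, c, ?_⟩
  have hlast : w ⟨((0 : ZMod N) - 1).val, ZMod.val_lt _⟩ = 0 := by
    have h := hval ⟨N - 1, by omega⟩
    simp only [Nat.sub_add_cancel hN, ZMod.natCast_self] at h
    simp only [h, w, Nat.sub_add_cancel hN, div_self (sub_ne_zero.mpr ht), c, one_mul, sub_self]
  ext r
  simp only [cyclicVec, hlast, hval]
  simp [w]

lemma prod_burauMatrix_mulVec_cyclicVec {n : ℕ} (hn : 3 ≤ n) {K : Type*} [Field K] {t : K}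
    (ht : t ^ (n - 1) ≠ 1) (y : ZMod (n - 1) → K) (c : K) :
    (List.ofFn fun i : Fin (n - 2) =>
      burauMatrix n K t (Fin.castLE (by omega) i)).prod *ᵥ cyclicVec (n - 1) t y c =
      cyclicVec (n - 1) t (fun i => t * y (i - 1)) c := by
  have hd : t ^ (n - 1) - 1 ≠ 0 := sub_ne_zero.mpr ht
  have hsucc : n - 2 + 1 = n - 1 := by omega
  have hcast : ((n - 2 : ℕ) : ZMod (n - 1)) = 0 - 1 := by
    rw [eq_sub_iff_add_eq]
    exact_mod_cast (congrArg _ hsucc).trans (ZMod.natCast_self (n - 1))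
  refine (prod_burauMatrix_mulVec t (n - 2) (by omega)
    (fun i => y (i : ZMod (n - 1)) - y 0 + (t ^ i - 1) / (t ^ (n - 1) - 1) * c) (by simp)).trans ?_
  ext r
  have hpow : t ^ (n - 1) = t ^ (n - 2) * t := by rw [← pow_succ, hsucc]
  simp only [cyclicVec, hsucc, ZMod.natCast_self, hcast, Nat.cast_add, Nat.cast_one,
    add_sub_cancel_right]
  split_ifs with hr
  · field_simp
    rw [hpow]
    ring
  · have hr' : (r : ℕ) = n - 2 := by omega
    simp only [hr', hsucc, hcast, sub_add_cancel]
    ring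

lemma prod_burauMatrix_pow_mulVec_cyclicVec {n : ℕ} (hn : 3 ≤ n) {K : Type*} [Field K] {t : K}
    (ht : t ^ (n - 1) ≠ 1) (y : ZMod (n - 1) → K) (c : K) (k : ℕ) :
    (List.ofFn fun i : Fin (n - 2) =>
      burauMatrix n K t (Fin.castLE (by omega) i)).prod ^ k *ᵥ cyclicVec (n - 1) t y c =
      cyclicVec (n - 1) t (fun i => t ^ k * y (i - k)) c := by
  induction k with
  | zero => simp
  | succ k ih =>
    rw [pow_succ', ← mulVec_mulVec, ih, prod_burauMatrix_mulVec_cyclicVec hn ht]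
    congr 1
    ext i
    rw [pow_succ', mul_assoc, Nat.cast_succ, sub_sub, add_comm (1 : ZMod (n - 1))]

/-- If `z^{(n-1)j} = 1` and `z^{n-1} ≠ 1`, then the image of `τ_{n-1}^j` under the reduced
Burau representation specialized at `t = z` is the identity matrix, i.e.
`(B₁(z) ⋯ B_{n-2}(z))^{(n-1)j} = I_{n-1}`. -/
theorem burau_subTwist_pow_eq_one (n j : ℕ) (hn : 3 ≤ n) (hj : 0 < j)
    (z : ℂ) (hz : z ≠ 0) (h1 : z ^ ((n - 1) * j) = 1) (h2 : z ^ (n - 1) ≠ 1) :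
    ((List.ofFn fun i : Fin (n - 2) =>
      burauMatrix n ℂ z (Fin.castLE (by omega) i)).prod) ^ ((n - 1) * j) = 1 := by
  have : NeZero (n - 1) := ⟨by omega⟩
  refine Matrix.ext_of_mulVec_single fun i => ?_
  obtain ⟨y, c, hv⟩ := cyclicVec_surjective h2 (Pi.single i 1)
  rw [← hv, prod_burauMatrix_pow_mulVec_cyclicVec hn h2, h1]
  simp
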